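/- For any 3-form φ on ℝ⁶ and any vectors X, Y, one has ι_X φ ∧ ι_Y F(φ) + ι_Y φ ∧ ι_X F(φ) = 0, and ι_Y ι_X φ ∧ F(φ) = φ ∧ ι_Y ι_X F(φ). -/

import Mathlib

noncomputable section

/-- The model 6-dimensional real vector space. -/
abbrev V6 := Fin 6 → ℝ

/-- Alternating k-forms on V6. -/
abbrev Form (k : ℕ) := AlternatingMap ℝ V6 ℝ (Fin k)

/-- Wedge product of alternating forms (determinant convention). -/
noncomputable def wedge {a b : ℕ} (φ : Form a) (ψ : Form b) : Form (a + b) :=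
  AlternatingMap.domDomCongr finSumFinEquiv
    ((TensorProduct.lid ℝ ℝ).toLinearMap.compAlternatingMap (AlternatingMap.domCoprod φ ψ))

infixl:70 " ⋏ " => wedge

/-- Interior product (contraction) of a form with a vector. -/
noncomputable def iota (v : V6) {k : ℕ} (φ : Form (k + 1)) : Form k :=
  AlternatingMap.curryLeft φ v

/-- The standard dual basis 1-forms e¹, …, e⁶ (0-indexed). -/
noncomputable def e (i : Fin 6) : Form 1 :=
  AlternatingMap.ofSubsingleton ℝ V6 ℝ 0 (LinearMap.proj i)

/-- The standard basis vectors e₁, …, e₆ (0-indexed). -/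
def b (i : Fin 6) : V6 := Pi.single i 1

/-- The standard volume form e¹∧e²∧e³∧e⁴∧e⁵∧e⁶. -/
noncomputable def vol : Form 6 := e 0 ⋏ e 1 ⋏ e 2 ⋏ e 3 ⋏ e 4 ⋏ e 5

open Equiv

theorem wedge_apply {a b : ℕ} (φ : Form a) (ψ : Form b) (v : Fin (a + b) → V6) :
    (φ ⋏ ψ) v = ∑ σ : Perm.ModSumCongr (Fin a) (Fin b), TensorProduct.lid ℝ ℝ
      (AlternatingMap.domCoprod.summand φ ψ σ (v ∘ finSumFinEquiv)) := by
  simp [wedge, AlternatingMap.domCoprod_apply, Function.comp_def]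

theorem lid_summand_mk {a b : ℕ} (φ : Form a) (ψ : Form b) (v : Fin a ⊕ Fin b → V6)
    (σ : Perm (Fin a ⊕ Fin b)) :
    TensorProduct.lid ℝ ℝ (AlternatingMap.domCoprod.summand φ ψ (Quotient.mk'' σ) v) =
      ((Perm.sign σ : ℤ) : ℝ) *
        (φ (fun i => v (σ (Sum.inl i))) * ψ (fun i => v (σ (Sum.inr i)))) := by
  rw [AlternatingMap.domCoprod.summand_mk'']
  rcases Int.units_eq_one_or (Perm.sign σ) with h | h <;> simp [h]

/-- The wedge product as a sum over a complete set `r` of representatives of the cosets of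
`Perm (Fin a) × Perm (Fin b)` in `Perm (Fin (a + b))`. -/
theorem wedge_apply_of_representatives {a b n : ℕ} (φ : Form a) (ψ : Form b) (v : Fin (a + b) → V6)
    (r : Fin n → Perm (Fin (a + b)))
    (hr : ∀ σ : Perm (Fin (a + b)), ∃ i,
      (∀ x : Fin a, ((r i)⁻¹ (σ (Fin.castAdd b x)) : ℕ) < a) ∧
        ∀ j, (∀ x : Fin a, ((r j)⁻¹ (σ (Fin.castAdd b x)) : ℕ) < a) → j = i) :
    (φ ⋏ ψ) v = ∑ i, ((Perm.sign (r i) : ℤ) : ℝ) *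
      (φ (fun x => v (r i (Fin.castAdd b x))) * ψ (fun x => v (r i (Fin.natAdd a x)))) := by
  set s : Fin n → Perm (Fin a ⊕ Fin b) := fun i => finSumFinEquiv.symm.permCongr (r i) with hs
  have key : ∀ (σ : Perm (Fin a ⊕ Fin b)) (i : Fin n),
      (Quotient.mk'' (s i) : Perm.ModSumCongr (Fin a) (Fin b)) = Quotient.mk'' σ ↔
        ∀ x : Fin a,
          ((r i)⁻¹ (finSumFinEquiv.permCongr σ (Fin.castAdd b x)) : ℕ) < a := by
    intro σ i
    have hval : ∀ x : Fin a, finSumFinEquiv (((s i)⁻¹ * σ) (Sum.inl x)) =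
        (r i)⁻¹ (finSumFinEquiv.permCongr σ (Fin.castAdd b x)) := by
      intro x
      rw [Perm.mul_apply, ← finSumFinEquiv_apply_left]
      apply (r i).injective
      obtain ⟨y, hy⟩ := (s i).surjective (σ (Sum.inl x))
      simp [← hy, hs, Equiv.symm_apply_eq]
    rw [Quotient.eq'', QuotientGroup.leftRel_apply]
    constructor
    · rintro ⟨⟨p, q⟩, h⟩ x
      rw [← hval, ← h]
      simp
    · intro h
      apply Perm.mem_sumCongrHom_range_of_perm_mapsTo_inl
      rintro _ ⟨x, rfl⟩
      have := h x
      rw [← hval] at this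
      rcases hy : ((s i)⁻¹ * σ) (Sum.inl x) with y | y
      · exact ⟨y, rfl⟩
      · rw [hy] at this
        simp at this
  have hbij : Function.Bijective
      (fun i => (Quotient.mk'' (s i) : Perm.ModSumCongr (Fin a) (Fin b))) := by
    rw [Function.bijective_iff_existsUnique]
    intro q
    induction q using Quotient.inductionOn' with
    | h σ => simpa only [key, ExistsUnique] using hr (finSumFinEquiv.permCongr σ)
  rw [wedge_apply]
  refine (Fintype.sum_bijective _ hbij _ _ fun i => ?_).symm
  rw [lid_summand_mk]
  simp [hs]

theorem form_two_swap (φ : Form 2) (x y : V6) : φ ![y, x] = -φ ![x, y] := by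
  rw [← φ.map_swap ![x, y] (show (0 : Fin 2) ≠ 1 by decide)]
  congr 1
  ext i
  fin_cases i <;> rfl

theorem form_three_swap_left (φ : Form 3) (x y z : V6) : φ ![y, x, z] = -φ ![x, y, z] := by
  rw [← φ.map_swap ![x, y, z] (show (0 : Fin 3) ≠ 1 by decide)]
  congr 1
  ext i
  fin_cases i <;> rfl

theorem form_three_swap_right (φ : Form 3) (x y z : V6) : φ ![x, z, y] = -φ ![x, y, z] := by
  rw [← φ.map_swap ![x, y, z] (show (1 : Fin 3) ≠ 2 by decide)]
  congr 1
  ext i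
  fin_cases i <;> rfl

theorem wedge_two_three (φ : Form 2) (ψ : Form 3) (a b c d e : V6) :
    (φ ⋏ ψ) ![a, b, c, d, e] = φ ![a, b] * ψ ![c, d, e] - φ ![a, c] * ψ ![b, d, e]
      + φ ![a, d] * ψ ![b, c, e] - φ ![a, e] * ψ ![b, c, d] + φ ![b, c] * ψ ![a, d, e]
      - φ ![b, d] * ψ ![a, c, e] + φ ![b, e] * ψ ![a, c, d] + φ ![c, d] * ψ ![a, b, e]
      - φ ![c, e] * ψ ![a, b, d] + φ ![d, e] * ψ ![a, b, c] := by
  have h : (φ ⋏ ψ) ![a, b, c, d, e] = φ ![a, b] * ψ ![c, d, e] + (-(φ ![a, c] * ψ ![b, d, e]) +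
      (-(φ ![a, d] * ψ ![c, b, e]) + (-(φ ![a, e] * ψ ![c, d, b]) +
      (-(φ ![c, b] * ψ ![a, d, e]) + (-(φ ![d, b] * ψ ![c, a, e]) +
      (-(φ ![e, b] * ψ ![c, d, a]) + (φ ![c, d] * ψ ![a, b, e] + (φ ![c, e] * ψ ![a, d, b] +
      φ ![d, e] * ψ ![c, a, b])))))))) := by
    rw [wedge_apply_of_representatives φ ψ _ ![1, swap 1 2, swap 1 3, swap 1 4, swap 0 2, swap 0 3,
      swap 0 4, swap 0 2 * swap 1 3, swap 0 2 * swap 1 4, swap 0 3 * swap 1 4] (by decide +kernel)]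
    simp only [Fin.sum_univ_succ]
    simp
    repeat' first
      | refine congrArg₂ (· + ·) ?_ ?_
      | refine congrArg₂ (· * ·) ?_ ?_
      | refine congrArg Neg.neg ?_
      | refine DFunLike.congr_arg _ ?_
    all_goals
      ext i : 1
      fin_cases i <;> rfl
  rw [h, form_two_swap φ b c, form_two_swap φ b d, form_two_swap φ b e,
    form_three_swap_left ψ b c e, form_three_swap_right ψ c b d, form_three_swap_left ψ b c d,
    form_three_swap_left ψ a c e, form_three_swap_right ψ c a d, form_three_swap_left ψ a c d,
    form_three_swap_right ψ a b d, form_three_swap_left ψ a c b, form_three_swap_right ψ a b c]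
  ring

theorem wedge_two_two (φ ψ : Form 2) (a b c d : V6) :
    (φ ⋏ ψ) ![a, b, c, d] = φ ![a, b] * ψ ![c, d] - φ ![a, c] * ψ ![b, d]
      + φ ![a, d] * ψ ![b, c] + φ ![b, c] * ψ ![a, d] - φ ![b, d] * ψ ![a, c]
      + φ ![c, d] * ψ ![a, b] := by
  have h : (φ ⋏ ψ) ![a, b, c, d] = φ ![a, b] * ψ ![c, d] + (-(φ ![a, c] * ψ ![b, d]) +
      (-(φ ![a, d] * ψ ![c, b]) + (-(φ ![c, b] * ψ ![a, d]) + (-(φ ![d, b] * ψ ![c, a]) +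
      φ ![c, d] * ψ ![a, b])))) := by
    rw [wedge_apply_of_representatives φ ψ _ ![1, swap 1 2, swap 1 3, swap 0 2, swap 0 3,
      swap 0 2 * swap 1 3] (by decide +kernel)]
    simp only [Fin.sum_univ_succ]
    simp
    repeat' first
      | refine congrArg₂ (· + ·) ?_ ?_
      | refine congrArg₂ (· * ·) ?_ ?_
      | refine congrArg Neg.neg ?_
      | refine DFunLike.congr_arg _ ?_
    all_goals
      ext i : 1
      fin_cases i <;> rfl
  rw [h, form_two_swap φ b c, form_two_swap φ b d, form_two_swap ψ b c, form_two_swap ψ a c]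
  ring

theorem wedge_one_three (φ : Form 1) (ψ : Form 3) (a b c d : V6) :
    (φ ⋏ ψ) ![a, b, c, d] = φ ![a] * ψ ![b, c, d] - φ ![b] * ψ ![a, c, d]
      + φ ![c] * ψ ![a, b, d] - φ ![d] * ψ ![a, b, c] := by
  have h : (φ ⋏ ψ) ![a, b, c, d] = φ ![a] * ψ ![b, c, d] + (-(φ ![b] * ψ ![a, c, d]) +
      (-(φ ![c] * ψ ![b, a, d]) + -(φ ![d] * ψ ![b, c, a]))) := by
    rw [wedge_apply_of_representatives φ ψ _ ![1, swap 0 1, swap 0 2, swap 0 3] (by decide +kernel)]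
    simp only [Fin.sum_univ_succ]
    simp
    repeat' first
      | refine congrArg₂ (· + ·) ?_ ?_
      | refine congrArg₂ (· * ·) ?_ ?_
      | refine congrArg Neg.neg ?_
      | refine DFunLike.congr_arg _ ?_
    all_goals
      ext i : 1
      fin_cases i <;> rfl
  rw [h, form_three_swap_left ψ a b d, form_three_swap_right ψ b a c, form_three_swap_left ψ a b c]
  ring

theorem wedge_three_one (φ : Form 3) (ψ : Form 1) (a b c d : V6) :
    (φ ⋏ ψ) ![a, b, c, d] = φ ![a, b, c] * ψ ![d] - φ ![a, b, d] * ψ ![c]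
      + φ ![a, c, d] * ψ ![b] - φ ![b, c, d] * ψ ![a] := by
  have h : (φ ⋏ ψ) ![a, b, c, d] = φ ![a, b, c] * ψ ![d] + (-(φ ![a, b, d] * ψ ![c]) +
      (-(φ ![a, d, c] * ψ ![b]) + -(φ ![d, b, c] * ψ ![a]))) := by
    rw [wedge_apply_of_representatives φ ψ _ ![1, swap 2 3, swap 1 3, swap 0 3] (by decide +kernel)]
    simp only [Fin.sum_univ_succ]
    simp
    repeat' first
      | refine congrArg₂ (· + ·) ?_ ?_
      | refine congrArg₂ (· * ·) ?_ ?_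
      | refine congrArg Neg.neg ?_
      | refine DFunLike.congr_arg _ ?_
    all_goals
      ext i : 1
      fin_cases i <;> rfl
  rw [h, form_three_swap_right φ a c d, form_three_swap_left φ b d c, form_three_swap_right φ b c d]
  ring

theorem wedge_e_apply {a : ℕ} (φ : Form a) (j : Fin 6) (v : Fin (a + 1) → V6)
    (hv : ∀ i : Fin a, v i.castSucc j = 0) :
    (φ ⋏ e j) v = φ (fun i => v i.castSucc) * v (Fin.last a) j := by
  rw [wedge_apply]
  refine (Finset.sum_eq_single (Quotient.mk'' 1) ?_ ?_).trans ?_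
  · intro q _ hq
    induction q using Quotient.inductionOn' with
    | h σ =>
      rw [lid_summand_mk]
      rcases hy : σ (Sum.inr 0) with y | y
      · have := hv y
        simp [e, hy]
        exact Or.inr this
      · refine absurd ?_ hq
        rw [Quotient.eq'', QuotientGroup.leftRel_apply, mul_one, inv_mem_iff]
        apply Perm.mem_sumCongrHom_range_of_perm_mapsTo_inl
        rintro _ ⟨x, rfl⟩
        rcases hz : σ (Sum.inl x) with z | z
        · exact ⟨z, rfl⟩
        · rw [Subsingleton.elim z y, ← hy] at hz
          simpa using σ.injective hz
  · simp
  · rw [lid_summand_mk]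
    simp [e, Fin.castSucc]
    left; rfl

theorem vol_basis : vol b = 1 := by
  unfold vol
  iterate 5
    rw [wedge_e_apply _ _ _ (by intro i; fin_cases i <;> simp [b])]
  simp [e, b]

theorem sum_neg_one_pow_mul_removeNth (ψ : Form 6) (L : V6 →ₗ[ℝ] ℝ) (v : Fin 7 → V6) :
    ∑ i : Fin 7, (-1 : ℝ) ^ (i : ℕ) * (L (v i) * ψ (i.removeNth v)) = 0 := by
  have h : AlternatingMap.alternatizeUncurryFin (L.smulRight ψ) v = 0 := by
    refine AlternatingMap.map_linearDependent _ v fun hv => ?_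
    have := hv.fintype_card_le_finrank
    simp at this
  rw [AlternatingMap.alternatizeUncurryFin_apply] at h
  rw [← h]
  refine Finset.sum_congr rfl fun i _ => ?_
  rcases Nat.even_or_odd (i : ℕ) with hi | hi <;> simp [hi.neg_one_pow]

theorem linear_mul_form_six (ψ : Form 6) (L : V6 →ₗ[ℝ] ℝ) (u p q r s t w : V6) :
    L u * ψ ![p, q, r, s, t, w] - L p * ψ ![u, q, r, s, t, w] + L q * ψ ![u, p, r, s, t, w]
      - L r * ψ ![u, p, q, s, t, w] + L s * ψ ![u, p, q, r, t, w]
      - L t * ψ ![u, p, q, r, s, w] + L w * ψ ![u, p, q, r, s, t] = 0 := by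
  have h := sum_neg_one_pow_mul_removeNth ψ L ![u, p, q, r, s, t, w]
  have h' : ∀ f : Fin 7 → ℝ, ∑ i : Fin 7, (-1 : ℝ) ^ (i : ℕ) * f i =
      f 0 - f 1 + f 2 - f 3 + f 4 - f 5 + f 6 := by
    intro f
    simp only [Fin.sum_univ_seven]
    norm_num
    ring
  rw [h'] at h
  rw [← h]
  repeat' first
    | refine congrArg₂ (· + ·) ?_ ?_
    | refine congrArg Neg.neg ?_
    | refine congrArg₂ (· - ·) ?_ ?_
    | refine congrArg₂ (· * ·) (congrArg L rfl) ?_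
    | refine DFunLike.congr_arg ψ ?_
  all_goals
    ext i : 1
    fin_cases i <;> rfl

theorem form_three_eq_zero_left (φ : Form 3) (x y : V6) : φ ![x, x, y] = 0 :=
  φ.map_eq_zero_of_eq _ (i := 0) (j := 1) rfl (by decide)

theorem form_three_eq_zero_right (φ : Form 3) (x y : V6) : φ ![x, y, y] = 0 :=
  φ.map_eq_zero_of_eq _ (i := 1) (j := 2) rfl (by decide)

theorem form_three_eq_zero_outer (φ : Form 3) (x y : V6) : φ ![x, y, x] = 0 :=
  φ.map_eq_zero_of_eq _ (i := 0) (j := 2) rfl (by decide)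

theorem linear_eq_sum (L : V6 →ₗ[ℝ] ℝ) (X : V6) : L X = ∑ i, X i * L (b i) := by
  conv_lhs => rw [← Finset.univ_sum_single X]
  rw [map_sum]
  refine Finset.sum_congr rfl fun i _ => ?_
  rw [← smul_eq_mul, ← map_smul, b, ← Pi.single_smul, smul_eq_mul, mul_one]

theorem form_six_update_basis (ψ : Form 6) (σ : Perm (Fin 6)) (X : V6) :
    ψ ![X, b (σ 1), b (σ 2), b (σ 3), b (σ 4), b (σ 5)] = X (σ 0) * ψ (b ∘ σ) := by
  let L : V6 →ₗ[ℝ] ℝ :=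
    { toFun := fun u => ψ.curryLeft u ![b (σ 1), b (σ 2), b (σ 3), b (σ 4), b (σ 5)]
      map_add' := by simp
      map_smul' := by simp }
  have hL : ∀ i, L (b (σ i)) = ψ ![b (σ i), b (σ 1), b (σ 2), b (σ 3), b (σ 4), b (σ 5)] :=
    fun _ => rfl
  change L X = _
  rw [linear_eq_sum, ← Equiv.sum_comp σ, Finset.sum_eq_single 0]
  · rw [hL]
    congr 2
    ext i : 1
    fin_cases i <;> rfl
  · intro i _ hi
    rw [hL, ψ.map_eq_zero_of_eq _ (i := 0) (j := i) ?_ hi.symm, mul_zero]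
    fin_cases i <;> rfl
  · simp

theorem vol_basis_perm_ne_zero (σ : Perm (Fin 6)) : vol (b ∘ σ) ≠ 0 := by
  rw [vol.map_perm, vol_basis]
  rcases Int.units_eq_one_or (Perm.sign σ) with h | h <;> simp [h]

theorem iota_apply_five (ψ : Form 6) (v p q r s t : V6) :
    iota v ψ ![p, q, r, s, t] = ψ ![v, p, q, r, s, t] :=
  rfl

theorem vol_apply_map (φ : Form 3) (K : V6 →ₗ[ℝ] V6)
    (hK : ∀ v : V6, iota (K v) vol = -(iota v φ ⋏ φ)) (v p q r s t : V6) :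
    vol ![K v, p, q, r, s, t] = -(φ ![v, p, q] * φ ![r, s, t] - φ ![v, p, r] * φ ![q, s, t]
      + φ ![v, p, s] * φ ![q, r, t] - φ ![v, p, t] * φ ![q, r, s] + φ ![v, q, r] * φ ![p, s, t]
      - φ ![v, q, s] * φ ![p, r, t] + φ ![v, q, t] * φ ![p, r, s] + φ ![v, r, s] * φ ![p, q, t]
      - φ ![v, r, t] * φ ![p, q, s] + φ ![v, s, t] * φ ![p, q, r]) := by
  have h : iota (K v) vol ![p, q, r, s, t] = -(iota v φ ⋏ φ) ![p, q, r, s, t] := by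
    rw [hK, AlternatingMap.neg_apply]
  rw [iota_apply_five, wedge_two_three] at h
  exact h

theorem apply_map_mul_vol_eq_zero (φ : Form 3) (K : V6 →ₗ[ℝ] V6)
    (hK : ∀ v : V6, iota (K v) vol = -(iota v φ ⋏ φ)) (X Z p q r s : V6) :
    φ ![X, K X, Z] * vol ![X, Z, p, q, r, s] = 0 := by
  let L : V6 →ₗ[ℝ] ℝ :=
    { toFun := fun u => φ.curryLeft u ![X, Z]
      map_add' := by simp
      map_smul' := by simp }
  have hL : ∀ u, L u = φ ![X, Z, u] := fun u => by
    rw [form_three_swap_right, form_three_swap_left, neg_neg]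
    rfl
  have h := linear_mul_form_six vol L (K X) X Z p q r s
  simp only [hL, vol_apply_map φ K hK, form_three_eq_zero_left, form_three_eq_zero_right,
    form_three_eq_zero_outer] at h
  rw [form_three_swap_right φ X Z (K X)]
  linear_combination -h

theorem apply_map_eq_zero (φ : Form 3) (K : V6 →ₗ[ℝ] V6)
    (hK : ∀ v : V6, iota (K v) vol = -(iota v φ ⋏ φ)) (X Z : V6) : φ ![X, K X, Z] = 0 := by
  by_cases hX : X = 0
  · exact φ.map_coord_zero 0 hX
  obtain ⟨k, hk⟩ := Function.ne_iff.mp hX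
  let L : V6 →ₗ[ℝ] ℝ :=
    { toFun := fun u => φ.curryLeft u ![X, K X]
      map_add' := by simp
      map_smul' := by simp }
  have hL : ∀ u, L u = φ ![X, K X, u] := fun u => by
    rw [form_three_swap_right, form_three_swap_left, neg_neg]
    rfl
  have hne : ∀ j, j ≠ k → L (b j) = 0 := by
    intro j hj
    let σ : Perm (Fin 6) := swap 0 k * swap 1 (swap 0 k j)
    have h0 : σ 0 = k := by
      have : (0 : Fin 6) ≠ swap 0 k j := by
        intro h
        apply hj
        rw [← swap_apply_self 0 k j, ← h, swap_apply_left]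
      simp [σ, swap_apply_of_ne_of_ne (show (0 : Fin 6) ≠ 1 by decide) this]
    have h1 : σ 1 = j := by simp [σ]
    have h := apply_map_mul_vol_eq_zero φ K hK X (b (σ 1)) (b (σ 2)) (b (σ 3)) (b (σ 4)) (b (σ 5))
    rw [form_six_update_basis, h0, h1] at h
    rw [hL]
    exact (mul_eq_zero.mp h).resolve_right (mul_ne_zero hk (vol_basis_perm_ne_zero σ))
  have hLk : L (b k) = 0 := by
    have h : L X = 0 := by rw [hL, form_three_eq_zero_outer]
    rw [linear_eq_sum, Finset.sum_eq_single k (fun j _ hj => by rw [hne j hj, mul_zero])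
      (by simp)] at h
    exact (mul_eq_zero.mp h).resolve_left hk
  rw [← hL, linear_eq_sum]
  refine Finset.sum_eq_zero fun j _ => ?_
  by_cases hj : j = k
  · rw [hj, hLk, mul_zero]
  · rw [hne j hj, mul_zero]

theorem shuffle_apply_map_self (φ : Form 3) (K : V6 →ₗ[ℝ] V6)
    (hK : ∀ v : V6, iota (K v) vol = -(iota v φ ⋏ φ)) (X a b c d : V6) :
    φ ![X, a, b] * φ ![K X, c, d] - φ ![X, a, c] * φ ![K X, b, d]
      + φ ![X, a, d] * φ ![K X, b, c] + φ ![X, b, c] * φ ![K X, a, d]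
      - φ ![X, b, d] * φ ![K X, a, c] + φ ![X, c, d] * φ ![K X, a, b] = 0 := by
  have h := vol_apply_map φ K hK X (K X) a b c d
  rw [vol.map_eq_zero_of_eq _ (i := 0) (j := 1) rfl (by decide)] at h
  simp only [apply_map_eq_zero φ K hK] at h
  linear_combination h

theorem form_three_add_left (φ : Form 3) (x x' y z : V6) :
    φ ![x + x', y, z] = φ ![x, y, z] + φ ![x', y, z] :=
  DFunLike.congr_fun (map_add φ.curryLeft x x') ![y, z]

theorem shuffle_apply_map (φ : Form 3) (K : V6 →ₗ[ℝ] V6)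
    (hK : ∀ v : V6, iota (K v) vol = -(iota v φ ⋏ φ)) (X Y a b c d : V6) :
    φ ![X, a, b] * φ ![K Y, c, d] - φ ![X, a, c] * φ ![K Y, b, d]
      + φ ![X, a, d] * φ ![K Y, b, c] + φ ![X, b, c] * φ ![K Y, a, d]
      - φ ![X, b, d] * φ ![K Y, a, c] + φ ![X, c, d] * φ ![K Y, a, b]
      + (φ ![Y, a, b] * φ ![K X, c, d] - φ ![Y, a, c] * φ ![K X, b, d]
      + φ ![Y, a, d] * φ ![K X, b, c] + φ ![Y, b, c] * φ ![K X, a, d]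
      - φ ![Y, b, d] * φ ![K X, a, c] + φ ![Y, c, d] * φ ![K X, a, b]) = 0 := by
  have h := shuffle_apply_map_self φ K hK (X + Y) a b c d
  simp only [map_add, form_three_add_left] at h
  linear_combination h - shuffle_apply_map_self φ K hK X a b c d
    - shuffle_apply_map_self φ K hK Y a b c d

/-- For any 3-form φ and vectors X, Y:
ι_X φ ∧ ι_Y F(φ) + ι_Y φ ∧ ι_X F(φ) = 0 and ι_Y ι_X φ ∧ F(φ) = φ ∧ ι_Y ι_X F(φ). -/
theorem contraction_identity_two (φ F : Form 3) (K : V6 →ₗ[ℝ] V6)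
    (hK : ∀ v : V6, iota (K v) vol = -(iota v φ ⋏ φ))
    (hF : ∀ v : V6, iota v F = (-2 : ℝ) • iota (K v) φ) :
    ∀ X Y : V6, iota X φ ⋏ iota Y F + iota Y φ ⋏ iota X F = 0 ∧
      iota Y (iota X φ) ⋏ F = φ ⋏ iota Y (iota X F) := by
  have hF' : ∀ x y z, F ![x, y, z] = -2 * φ ![K x, y, z] := fun x y z =>
    DFunLike.congr_fun (hF x) ![y, z]
  have hS : ∀ X Y a b c d : V6, φ ![X, a, b] * F ![Y, c, d] - φ ![X, a, c] * F ![Y, b, d]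
      + φ ![X, a, d] * F ![Y, b, c] + φ ![X, b, c] * F ![Y, a, d]
      - φ ![X, b, d] * F ![Y, a, c] + φ ![X, c, d] * F ![Y, a, b]
      + (φ ![Y, a, b] * F ![X, c, d] - φ ![Y, a, c] * F ![X, b, d]
      + φ ![Y, a, d] * F ![X, b, c] + φ ![Y, b, c] * F ![X, a, d]
      - φ ![Y, b, d] * F ![X, a, c] + φ ![Y, c, d] * F ![X, a, b]) = 0 := by
    intro X Y a b c d
    simp only [hF']
    linear_combination -2 * shuffle_apply_map φ K hK X Y a b c d
  have eta : ∀ v : Fin 4 → V6, v = ![v 0, v 1, v 2, v 3] := fun v => by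
    ext i : 1
    fin_cases i <;> rfl
  intro X Y
  constructor
  · ext v
    rw [eta v]
    generalize v 0 = a, v 1 = b, v 2 = c, v 3 = d
    change (iota X φ ⋏ iota Y F) ![a, b, c, d] + (iota Y φ ⋏ iota X F) ![a, b, c, d] = 0
    rw [wedge_two_two, wedge_two_two]
    exact hS X Y a b c d
  · ext v
    rw [eta v]
    generalize v 0 = a, v 1 = b, v 2 = c, v 3 = d
    refine (wedge_one_three _ _ a b c d).trans (Eq.trans ?_ (wedge_three_one _ _ a b c d).symm)
    change φ ![X, Y, a] * F ![b, c, d] - φ ![X, Y, b] * F ![a, c, d] + φ ![X, Y, c] * F ![a, b, d]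
      - φ ![X, Y, d] * F ![a, b, c] = φ ![a, b, c] * F ![X, Y, d] - φ ![a, b, d] * F ![X, Y, c]
      + φ ![a, c, d] * F ![X, Y, b] - φ ![b, c, d] * F ![X, Y, a]
    have ha := hS X a Y b c d
    have hb := hS X b Y a c d
    have hc := hS X c Y a b d
    have hd := hS X d Y a b c
    simp only [form_three_swap_left _ Y a, form_three_swap_left _ Y b, form_three_swap_left _ Y c,
      form_three_swap_left _ Y d, form_three_swap_left _ a b, form_three_swap_left _ a c,
      form_three_swap_left _ a d, form_three_swap_left _ b c, form_three_swap_left _ b d,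
      form_three_swap_right _ _ b c, form_three_swap_right _ _ b d,
      form_three_swap_right _ _ c d, form_three_swap_right _ Y a b, form_three_swap_right _ Y a c,
      form_three_swap_right _ Y a d] at ha hb hc hd
    linear_combination (-2 / 3) * hS X Y a b c d - ha / 3 + hb / 3 - hc / 3 + hd / 3
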